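/- Assume the COLD setup for some k ≥ 1, fix subsets S, S̄ ⊆ {1,…,k}, and let E split X into sets of size 2. Then there exists a random variable U, adjoinable to all the given variables, that is uniform over a 3-element set and satisfies I(U; (E, V_S, V̄_S̄)) = 0 and H(F | V_S, V̄_S̄, E, U) = 0, if and only if a_e ≤ 1 for every e with P(E=e) > 0. -/

import Mathlib

namespace CIPaper

/-- A bundled probability space. -/
structure ProbSpace where
  carrier : Type
  [inst : MeasurableSpace carrier]
  μ : MeasureTheory.Measure carrier
  [isProb : MeasureTheory.IsProbabilityMeasure μ]

attribute [instance] ProbSpace.inst ProbSpace.isProb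

/-- A bundled finite measurable alphabet, used as value space of auxiliary random variables. -/
structure FinAlphabet where
  carrier : Type
  [fin : Fintype carrier]
  [ms : MeasurableSpace carrier]
  [msc : MeasurableSingletonClass carrier]

attribute [instance] FinAlphabet.fin FinAlphabet.ms FinAlphabet.msc

open MeasureTheory ProbabilityTheory Real

variable {Ω : Type*} [MeasurableSpace Ω] {S T U : Type*}

/-- P(X = x). -/
noncomputable def pr (μ : Measure Ω) (X : Ω → S) (x : S) : ℝ :=
  (μ (X ⁻¹' {x})).toReal

/-- Shannon entropy (base 2) of a finite-valued random variable. -/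
noncomputable def ent (μ : Measure Ω) [Fintype S] (X : Ω → S) : ℝ :=
  (∑ x, Real.negMulLog (pr μ X x)) / Real.log 2

/-- Conditional entropy H(X|Y). -/
noncomputable def condEnt (μ : Measure Ω) [Fintype S] [Fintype T]
    (X : Ω → S) (Y : Ω → T) : ℝ :=
  ent μ (fun ω => (X ω, Y ω)) - ent μ Y

/-- Mutual information I(X;Y). -/
noncomputable def mi (μ : Measure Ω) [Fintype S] [Fintype T]
    (X : Ω → S) (Y : Ω → T) : ℝ :=
  ent μ X + ent μ Y - ent μ (fun ω => (X ω, Y ω))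

/-- Conditional mutual information I(X;Y|Z). -/
noncomputable def cmi (μ : Measure Ω) [Fintype S] [Fintype T] [Fintype U]
    (X : Ω → S) (Y : Ω → T) (Z : Ω → U) : ℝ :=
  ent μ (fun ω => (X ω, Z ω)) + ent μ (fun ω => (Y ω, Z ω))
    - ent μ (fun ω => (X ω, (Y ω, Z ω))) - ent μ Z

/-- The support of a random variable: values of positive probability. -/
def support (μ : Measure Ω) (X : Ω → S) : Set S := {x | 0 < pr μ X x}

/-- X is uniformly distributed over its support. -/
def IsUniform (μ : Measure Ω) (X : Ω → S) : Prop :=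
  ∀ x ∈ support μ X, ∀ y ∈ support μ X, pr μ X x = pr μ X y

/-- X is uniformly distributed over a support of size n. -/
def UniformOn (μ : Measure Ω) (X : Ω → S) (n : ℕ) : Prop :=
  IsUniform μ X ∧ (support μ X).ncard = n

/-- The TRIPLE predicate: pairwise independence plus each variable a function of the
other two. -/
def TRIPLE (μ : Measure Ω) [Fintype S] [Fintype T] [Fintype U]
    (X : Ω → S) (Y : Ω → T) (Z : Ω → U) : Prop :=
  condEnt μ X (fun ω => (Y ω, Z ω)) = 0 ∧ condEnt μ Y (fun ω => (X ω, Z ω)) = 0 ∧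
    condEnt μ Z (fun ω => (X ω, Y ω)) = 0 ∧
    mi μ X Y = 0 ∧ mi μ X Z = 0 ∧ mi μ Y Z = 0

end CIPaper

namespace CIPaper

open MeasureTheory ProbabilityTheory Real

/-- E splits X into sets of size l: E is a function of X and, conditioned on any value e
of positive probability, X is uniform over exactly l values. -/
def Splits {Ω : Type*} [MeasurableSpace Ω] (μ : Measure Ω) {SX SE : Type*}
    [Fintype SX] [Fintype SE] (X : Ω → SX) (E : Ω → SE) (l : ℕ) : Prop :=
  condEnt μ E X = 0 ∧
  ∀ e : SE, 0 < pr μ E e →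
    (∀ x : SX, pr μ (fun ω => (X ω, E ω)) (x, e) = 0 ∨
        pr μ (fun ω => (X ω, E ω)) (x, e) = pr μ E e / l) ∧
    Set.ncard {x : SX | 0 < pr μ (fun ω => (X ω, E ω)) (x, e)} = l

/-- a_e: the number of values x of X compatible with E = e whose label w(x) satisfies
sat(w(x), S, S̄) = 1. -/
noncomputable def aCount {Ω : Type*} [MeasurableSpace Ω] (μ : Measure Ω) {SX SE : Type*}
    (k : ℕ) (X : Ω → SX) (E : Ω → SE) (wfun : SX → (Fin k → Fin 2))
    (S Sb : Finset (Fin k)) (e : SE) : ℕ :=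
  Set.ncard {x : SX | 0 < pr μ (fun ω => (X ω, E ω)) (x, e) ∧
    (∀ i ∈ S, wfun x i = 1) ∧ ∀ i ∈ Sb, wfun x i = 0}

section FiniteLaws

variable {Ω : Type*} [MeasurableSpace Ω] {μ : Measure Ω} {A B C : Type*}

lemma pr_nonneg (X : Ω → A) (x : A) : 0 ≤ pr μ X x := ENNReal.toReal_nonneg

lemma pr_congr_of_ae_iff {X : Ω → A} {Y : Ω → B} {x : A} {y : B}
    (h : ∀ᵐ ω ∂μ, X ω = x ↔ Y ω = y) : pr μ X x = pr μ Y y := by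
  unfold pr
  congr 1
  refine measure_congr ?_
  filter_upwards [h] with ω hω
  exact propext hω

lemma pr_eq_zero_of_ae_ne {X : Ω → A} {x : A} (h : ∀ᵐ ω ∂μ, X ω ≠ x) : pr μ X x = 0 := by
  have : μ (X ⁻¹' {x}) = 0 := by
    rw [ae_iff] at h
    simpa [Set.preimage] using h
  simp [pr, this]

lemma pr_eq_of_identDistrib [MeasurableSpace A] [MeasurableSingletonClass A]
    {Ω' : Type*} [MeasurableSpace Ω'] {ν : Measure Ω'}
    {X : Ω → A} {Y : Ω' → A} (h : IdentDistrib X Y μ ν) (x : A) : pr μ X x = pr ν Y x := by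
  unfold pr
  rw [h.measure_preimage_eq (measurableSet_singleton x)]

variable [IsProbabilityMeasure μ]

lemma ae_ne_of_pr_eq_zero {X : Ω → A} {x : A} (h : pr μ X x = 0) : ∀ᵐ ω ∂μ, X ω ≠ x := by
  rw [ae_iff]
  have := (ENNReal.toReal_eq_zero_iff _).1 h
  simpa [Set.preimage] using this

lemma ae_pr_pos [Finite A] (X : Ω → A) : ∀ᵐ ω ∂μ, 0 < pr μ X (X ω) := by
  have : ∀ᵐ ω ∂μ, ∀ x : A, pr μ X x = 0 → X ω ≠ x := by
    rw [ae_all_iff]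
    intro x
    by_cases hx : pr μ X x = 0
    · filter_upwards [ae_ne_of_pr_eq_zero hx] with ω hω _ using hω
    · exact Filter.Eventually.of_forall fun ω h => absurd h hx
  filter_upwards [this] with ω hω
  exact lt_of_le_of_ne (pr_nonneg _ _) fun h => hω _ h.symm rfl

lemma pr_pair_le_snd (X : Ω → A) (Y : Ω → B) (x : A) (y : B) :
    pr μ (fun ω => (X ω, Y ω)) (x, y) ≤ pr μ Y y := by
  refine ENNReal.toReal_mono (measure_ne_top _ _) (measure_mono fun ω h => ?_)
  simp at h ⊢
  exact h.2

lemma pr_pair_le_fst (X : Ω → A) (Y : Ω → B) (x : A) (y : B) :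
    pr μ (fun ω => (X ω, Y ω)) (x, y) ≤ pr μ X x := by
  refine ENNReal.toReal_mono (measure_ne_top _ _) (measure_mono fun ω h => ?_)
  simp at h ⊢
  exact h.1

variable [MeasurableSpace A] [MeasurableSingletonClass A]

open Classical in
lemma pr_comp [Fintype A] {Z : Ω → A} (hZ : Measurable Z) (g : A → B) (y : B) :
    pr μ (fun ω => g (Z ω)) y = ∑ z, if g z = y then pr μ Z z else 0 := by
  have h : (fun ω => g (Z ω)) ⁻¹' {y}
      = ⋃ z ∈ Finset.univ.filter (fun z => g z = y), Z ⁻¹' {z} := by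
    ext ω; simp
  unfold pr
  rw [h, measure_biUnion_finset, ENNReal.toReal_sum, Finset.sum_filter]
  · intros; exact measure_ne_top _ _
  · intro a _ b _ hab
    exact Disjoint.preimage _ (by simpa using hab)
  · intro b _
    exact hZ (measurableSet_singleton b)

variable [MeasurableSpace B] [MeasurableSingletonClass B]
  [MeasurableSpace C] [MeasurableSingletonClass C]

lemma sum_pr [Fintype A] {X : Ω → A} (hX : Measurable X) : ∑ x, pr μ X x = 1 := by
  have := pr_comp (μ := μ) hX (fun _ => ()) ()
  simp only [if_true] at this
  rw [← this]
  simp [pr]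

lemma pr_snd [Fintype A] [Fintype B] {X : Ω → A} {Y : Ω → B} (hX : Measurable X)
    (hY : Measurable Y) (y : B) : ∑ x, pr μ (fun ω => (X ω, Y ω)) (x, y) = pr μ Y y := by
  have := pr_comp (μ := μ) (hX.prodMk hY) Prod.snd y
  dsimp only at this
  classical
  rw [this, Fintype.sum_prod_type]
  simp

lemma pr_fst [Fintype A] [Fintype B] {X : Ω → A} {Y : Ω → B} (hX : Measurable X)
    (hY : Measurable Y) (x : A) : ∑ y, pr μ (fun ω => (X ω, Y ω)) (x, y) = pr μ X x := by
  have := pr_comp (μ := μ) (hX.prodMk hY) Prod.fst x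
  dsimp only at this
  classical
  rw [this, Fintype.sum_prod_type_right]
  simp

lemma identDistrib_of_pr {Ω' : Type*} [MeasurableSpace Ω'] {ν : Measure Ω'}
    [IsProbabilityMeasure ν] [Finite A] {X : Ω → A} {Y : Ω' → A} (hX : Measurable X)
    (hY : Measurable Y) (h : ∀ x, pr μ X x = pr ν Y x) : IdentDistrib X Y μ ν where
  aemeasurable_fst := hX.aemeasurable
  aemeasurable_snd := hY.aemeasurable
  map_eq := by
    refine Measure.ext_of_singleton fun x => ?_
    rw [Measure.map_apply hX (measurableSet_singleton x),
      Measure.map_apply hY (measurableSet_singleton x)]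
    exact (ENNReal.toReal_eq_toReal_iff' (measure_ne_top _ _) (measure_ne_top _ _)).1 (h x)

lemma condEnt_eq_sum [Fintype A] [Fintype B] {X : Ω → A} {Y : Ω → B} (hX : Measurable X)
    (hY : Measurable Y) :
    condEnt μ X Y = (∑ z : A × B, pr μ (fun ω => (X ω, Y ω)) z *
      (Real.log (pr μ Y z.2) - Real.log (pr μ (fun ω => (X ω, Y ω)) z))) / Real.log 2 := by
  unfold condEnt ent
  rw [← sub_div]
  congr 1
  have : ∑ y, Real.negMulLog (pr μ Y y)
      = ∑ z : A × B, - (pr μ (fun ω => (X ω, Y ω)) z * Real.log (pr μ Y z.2)) := by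
    rw [Fintype.sum_prod_type_right]
    refine Finset.sum_congr rfl fun y _ => ?_
    dsimp only
    rw [Finset.sum_neg_distrib, ← Finset.sum_mul, pr_snd hX hY]
    simp [Real.negMulLog]
  rw [this, ← Finset.sum_sub_distrib]
  refine Finset.sum_congr rfl fun z _ => ?_
  simp only [Real.negMulLog]
  ring

lemma condEnt_eq_zero_iff [Fintype A] [Fintype B] {X : Ω → A} {Y : Ω → B} (hX : Measurable X)
    (hY : Measurable Y) :
    condEnt μ X Y = 0 ↔ ∀ x y, pr μ (fun ω => (X ω, Y ω)) (x, y) = 0 ∨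
      pr μ (fun ω => (X ω, Y ω)) (x, y) = pr μ Y y := by
  have hl : Real.log 2 ≠ 0 := (Real.log_pos one_lt_two).ne'
  rw [condEnt_eq_sum hX hY, div_eq_zero_iff, or_iff_left hl,
    Finset.sum_eq_zero_iff_of_nonneg]
  · constructor
    · intro h x y
      have h1 := h (x, y) (Finset.mem_univ _)
      rcases mul_eq_zero.1 h1 with h2 | h2
      · exact Or.inl h2
      · rcases (pr_nonneg (μ := μ) (fun ω => (X ω, Y ω)) (x, y)).eq_or_lt with h3 | h3
        · exact Or.inl h3.symm
        · right
          exact (Real.log_injOn_pos (h3.trans_le (pr_pair_le_snd X Y x y)) h3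
            (sub_eq_zero.1 h2)).symm
    · rintro h ⟨x, y⟩ -
      rcases h x y with h1 | h1 <;> simp [h1]
  · rintro ⟨x, y⟩ -
    rcases (pr_nonneg (μ := μ) (fun ω => (X ω, Y ω)) (x, y)).eq_or_lt with h3 | h3
    · simp [← h3]
    · exact mul_nonneg h3.le (sub_nonneg.2 (Real.log_le_log h3 (pr_pair_le_snd X Y x y)))

/-- Gibbs' inequality, equality case. -/
lemma eq_of_sum_mul_log_sub_log_eq_zero {ι : Type*} [Fintype ι] {p q : ι → ℝ}
    (hp : ∀ i, 0 ≤ p i) (hq : ∀ i, 0 ≤ q i) (hac : ∀ i, q i = 0 → p i = 0)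
    (hsum : ∑ i, p i = ∑ i, q i) (h : ∑ i, p i * (Real.log (p i) - Real.log (q i)) = 0) (i : ι) :
    p i = q i := by
  have key : ∀ j, 0 ≤ p j * (Real.log (p j) - Real.log (q j)) - p j + q j ∧
      (p j * (Real.log (p j) - Real.log (q j)) - p j + q j = 0 → p j = q j) := by
    intro j
    rcases (hq j).eq_or_lt with h0 | h0
    · simp [hac j h0.symm, ← h0]
    · have e : p j * (Real.log (p j) - Real.log (q j)) - p j + q j
          = q j * InformationTheory.klFun (p j / q j) := by
        rw [InformationTheory.klFun]
        rcases (hp j).eq_or_lt with h1 | h1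
        · simp [← h1]
        · rw [Real.log_div h1.ne' h0.ne']
          field_simp
          ring
      have hnn : 0 ≤ p j / q j := div_nonneg (hp j) h0.le
      rw [e]
      refine ⟨mul_nonneg h0.le (InformationTheory.klFun_nonneg hnn), fun h2 => ?_⟩
      have h3 := (InformationTheory.klFun_eq_zero_iff hnn).1
        ((mul_eq_zero.1 h2).resolve_left h0.ne')
      field_simp at h3
      exact h3
  have h0 : ∑ j, (p j * (Real.log (p j) - Real.log (q j)) - p j + q j) = 0 := by
    rw [Finset.sum_add_distrib, Finset.sum_sub_distrib, h, hsum]; ring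
  exact (key i).2 ((Finset.sum_eq_zero_iff_of_nonneg fun j _ => (key j).1).1 h0 i
    (Finset.mem_univ _))

lemma mi_eq_sum [Fintype A] [Fintype B] {X : Ω → A} {Y : Ω → B} (hX : Measurable X)
    (hY : Measurable Y) :
    mi μ X Y = (∑ z : A × B, pr μ (fun ω => (X ω, Y ω)) z *
      (Real.log (pr μ (fun ω => (X ω, Y ω)) z)
        - Real.log (pr μ X z.1 * pr μ Y z.2))) / Real.log 2 := by
  have hXs : ∑ x, Real.negMulLog (pr μ X x)
      = ∑ z : A × B, - (pr μ (fun ω => (X ω, Y ω)) z * Real.log (pr μ X z.1)) := by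
    rw [Fintype.sum_prod_type]
    refine Finset.sum_congr rfl fun x _ => ?_
    dsimp only
    rw [Finset.sum_neg_distrib, ← Finset.sum_mul, pr_fst hX hY]
    simp [Real.negMulLog]
  have hYs : ∑ y, Real.negMulLog (pr μ Y y)
      = ∑ z : A × B, - (pr μ (fun ω => (X ω, Y ω)) z * Real.log (pr μ Y z.2)) := by
    rw [Fintype.sum_prod_type_right]
    refine Finset.sum_congr rfl fun y _ => ?_
    dsimp only
    rw [Finset.sum_neg_distrib, ← Finset.sum_mul, pr_snd hX hY]
    simp [Real.negMulLog]
  unfold mi ent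
  rw [← add_div, ← sub_div, hXs, hYs, ← Finset.sum_add_distrib, ← Finset.sum_sub_distrib]
  congr 1
  refine Finset.sum_congr rfl fun ⟨x, y⟩ _ => ?_
  rcases (pr_nonneg (μ := μ) (fun ω => (X ω, Y ω)) (x, y)).eq_or_lt with h | h
  · simp [← h]
  · rw [Real.log_mul (h.trans_le (pr_pair_le_fst X Y x y)).ne'
      (h.trans_le (pr_pair_le_snd X Y x y)).ne']
    simp only [Real.negMulLog]
    ring

lemma mi_eq_zero_iff [Fintype A] [Fintype B] {X : Ω → A} {Y : Ω → B} (hX : Measurable X)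
    (hY : Measurable Y) :
    mi μ X Y = 0 ↔ ∀ x y, pr μ (fun ω => (X ω, Y ω)) (x, y) = pr μ X x * pr μ Y y := by
  have hl : Real.log 2 ≠ 0 := (Real.log_pos one_lt_two).ne'
  rw [mi_eq_sum hX hY, div_eq_zero_iff, or_iff_left hl]
  constructor
  · intro h x y
    refine eq_of_sum_mul_log_sub_log_eq_zero (q := fun z : A × B => pr μ X z.1 * pr μ Y z.2)
      (fun z => pr_nonneg _ _) (fun z => mul_nonneg (pr_nonneg _ _) (pr_nonneg _ _)) ?_ ?_ h (x, y)
    · rintro ⟨x, y⟩ h0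
      refine le_antisymm ?_ (pr_nonneg _ _)
      rcases mul_eq_zero.1 h0 with h1 | h1
      · exact (pr_pair_le_fst X Y x y).trans h1.le
      · exact (pr_pair_le_snd X Y x y).trans h1.le
    · rw [sum_pr (hX.prodMk hY), Fintype.sum_prod_type]
      simp only [← Finset.mul_sum, sum_pr hY, mul_one, sum_pr hX]
  · intro h
    refine Finset.sum_eq_zero fun ⟨x, y⟩ _ => ?_
    simp [h x y]

lemma pr_mul_of_cmi_eq_zero [Fintype A] [Fintype B] [Fintype C] {X : Ω → A} {Y : Ω → B}
    {Z : Ω → C} (hX : Measurable X) (hY : Measurable Y) (hZ : Measurable Z)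
    (h : cmi μ X Y Z = 0) (x : A) (y : B) (z : C) :
    pr μ (fun ω => (X ω, Y ω, Z ω)) (x, y, z) * pr μ Z z
      = pr μ (fun ω => (X ω, Z ω)) (x, z) * pr μ (fun ω => (Y ω, Z ω)) (y, z) := by
  have hYZ := hY.prodMk hZ
  have hXZ := hX.prodMk hZ
  have mXZ : ∀ x z, ∑ y, pr μ (fun ω => (X ω, Y ω, Z ω)) (x, y, z)
      = pr μ (fun ω => (X ω, Z ω)) (x, z) := by
    intro x z
    rw [← pr_snd hY hXZ]
    refine Finset.sum_congr rfl fun y _ => pr_congr_of_ae_iff (.of_forall fun ω => ?_)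
    simp only [Prod.mk.injEq]; tauto
  have mYZ : ∀ y z, ∑ x, pr μ (fun ω => (X ω, Y ω, Z ω)) (x, y, z)
      = pr μ (fun ω => (Y ω, Z ω)) (y, z) := fun y z => pr_snd hX hYZ (y, z)
  set p : A × B × C → ℝ := pr μ (fun ω => (X ω, Y ω, Z ω)) with hp
  set a := pr μ (fun ω => (X ω, Z ω)) with ha
  set b := pr μ (fun ω => (Y ω, Z ω)) with hb
  set c := pr μ Z with hc
  have pn : ∀ i, 0 ≤ p i := fun i => pr_nonneg _ _
  have an : ∀ i, 0 ≤ a i := fun i => pr_nonneg _ _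
  have bn : ∀ i, 0 ≤ b i := fun i => pr_nonneg _ _
  have cn : ∀ i, 0 ≤ c i := fun i => pr_nonneg _ _
  have mZa : ∀ z, ∑ x, a (x, z) = c z := fun z => pr_snd hX hZ z
  have mZb : ∀ z, ∑ y, b (y, z) = c z := fun z => pr_snd hY hZ z
  have pa : ∀ x y z, p (x, y, z) ≤ a (x, z) := fun x y z => by
    rw [← mXZ]
    exact Finset.single_le_sum (f := fun y => p (x, y, z)) (fun _ _ => pn _) (Finset.mem_univ y)
  have pb : ∀ x y z, p (x, y, z) ≤ b (y, z) := fun x y z => by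
    rw [← mYZ]
    exact Finset.single_le_sum (f := fun x => p (x, y, z)) (fun _ _ => pn _) (Finset.mem_univ x)
  have bc : ∀ y z, b (y, z) ≤ c z := fun y z => pr_pair_le_snd Y Z y z
  have ac : ∀ x z, a (x, z) ≤ c z := fun y z => pr_pair_le_snd X Z y z
  have hl : Real.log 2 ≠ 0 := (Real.log_pos one_lt_two).ne'
  have sa : ∑ i, Real.negMulLog (a i)
      = ∑ w : A × B × C, - (p w * Real.log (a (w.1, w.2.2))) := by
    simp only [Fintype.sum_prod_type]
    refine Finset.sum_congr rfl fun x _ => ?_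
    rw [Finset.sum_comm]
    refine Finset.sum_congr rfl fun z _ => ?_
    rw [Finset.sum_neg_distrib, ← Finset.sum_mul, mXZ]
    simp [Real.negMulLog]
  have sb : ∑ i, Real.negMulLog (b i)
      = ∑ w : A × B × C, - (p w * Real.log (b w.2)) := by
    rw [Fintype.sum_prod_type_right (f := fun w : A × B × C => -(p w * Real.log (b w.2)))]
    refine Finset.sum_congr rfl fun ⟨y, z⟩ _ => ?_
    dsimp only
    rw [Finset.sum_neg_distrib, ← Finset.sum_mul, mYZ]
    simp [Real.negMulLog]
  have sc : ∑ i, Real.negMulLog (c i)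
      = ∑ w : A × B × C, - (p w * Real.log (c w.2.2)) := by
    rw [Fintype.sum_prod_type_right, Fintype.sum_prod_type_right]
    refine Finset.sum_congr rfl fun z _ => ?_
    simp only [Finset.sum_neg_distrib, ← Finset.sum_mul, mYZ, mZb]
    simp [Real.negMulLog]
  have hsum : ∑ w : A × B × C, p w * (Real.log (p w)
      - Real.log (a (w.1, w.2.2) * b w.2 / c w.2.2)) = 0 := by
    unfold cmi ent at h
    rw [← ha, ← hb, ← hp, ← hc, ← add_div, ← sub_div, ← sub_div, div_eq_zero_iff,
      or_iff_left hl, sa, sb, sc, ← Finset.sum_add_distrib, ← Finset.sum_sub_distrib,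
      ← Finset.sum_sub_distrib] at h
    rw [← h]
    refine Finset.sum_congr rfl fun ⟨x, y, z⟩ _ => ?_
    rcases (pn (x, y, z)).eq_or_lt with h0 | h0
    · simp [← h0]
    · have ha0 := h0.trans_le (pa x y z)
      have hb0 := h0.trans_le (pb x y z)
      have hc0 := hb0.trans_le (bc y z)
      dsimp only
      rw [Real.log_div (mul_pos ha0 hb0).ne' hc0.ne', Real.log_mul ha0.ne' hb0.ne']
      simp only [Real.negMulLog]
      ring
  have main : p (x, y, z) = a (x, z) * b (y, z) / c z := by
    refine eq_of_sum_mul_log_sub_log_eq_zero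
      (q := fun w : A × B × C => a (w.1, w.2.2) * b w.2 / c w.2.2) pn
      (fun w => div_nonneg (mul_nonneg (an _) (bn _)) (cn _)) ?_ ?_ hsum (x, y, z)
    · rintro ⟨x, y, z⟩ h0
      refine le_antisymm ?_ (pn _)
      rcases div_eq_zero_iff.1 h0 with h1 | h1
      · rcases mul_eq_zero.1 h1 with h2 | h2
        · exact (pa x y z).trans h2.le
        · exact (pb x y z).trans h2.le
      · exact (pb x y z).trans ((bc y z).trans h1.le)
    · rw [sum_pr (hX.prodMk hYZ), Fintype.sum_prod_type_right, Fintype.sum_prod_type_right]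
      rw [← sum_pr (μ := μ) hZ]
      refine Finset.sum_congr rfl fun z _ => ?_
      simp only [← Finset.sum_mul, ← Finset.sum_div, mZa, ← Finset.mul_sum, mZb]
      change c z = c z * c z / c z
      rw [mul_self_div_self]
  rcases eq_or_ne (c z) 0 with h0 | h0
  · have : b (y, z) = 0 := le_antisymm ((bc y z).trans h0.le) (bn _)
    rw [h0, this]; ring
  · rw [main]; field_simp

lemma pr_comp_mul_of_cmi_eq_zero {D : Type*} [MeasurableSpace D] [MeasurableSingletonClass D]
    [Fintype D] [Fintype A] [Fintype B] [Fintype C]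
    {X : Ω → D} {Y : Ω → B} {Z : Ω → C} (hX : Measurable X) (hY : Measurable Y)
    (hZ : Measurable Z) (h : cmi μ X Y Z = 0) (g : D → A) (a : A) (y : B) (z : C) :
    pr μ (fun ω => (g (X ω), Y ω, Z ω)) (a, y, z) * pr μ Z z
      = pr μ (fun ω => (g (X ω), Z ω)) (a, z) * pr μ (fun ω => (Y ω, Z ω)) (y, z) := by
  have hg : Measurable fun ω => g (X ω) := (measurable_of_finite g).comp hX
  rw [← pr_snd hX (hg.prodMk (hY.prodMk hZ)), ← pr_snd hX (hg.prodMk hZ), Finset.sum_mul,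
    Finset.sum_mul]
  refine Finset.sum_congr rfl fun x _ => ?_
  by_cases hx : g x = a
  · rw [show pr μ (fun ω => (X ω, g (X ω), Y ω, Z ω)) (x, a, y, z)
        = pr μ (fun ω => (X ω, Y ω, Z ω)) (x, y, z) from
        pr_congr_of_ae_iff (.of_forall fun ω => by simp only [Prod.mk.injEq]; grind),
      show pr μ (fun ω => (X ω, g (X ω), Z ω)) (x, a, z) = pr μ (fun ω => (X ω, Z ω)) (x, z) from
        pr_congr_of_ae_iff (.of_forall fun ω => by simp only [Prod.mk.injEq]; grind)]
    exact pr_mul_of_cmi_eq_zero hX hY hZ h x y z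
  · have hne : ∀ ω, X ω = x → g (X ω) ≠ a := fun ω hω => hω ▸ hx
    rw [pr_eq_zero_of_ae_ne (X := fun ω => (X ω, g (X ω), Y ω, Z ω))
        (.of_forall fun ω => by simp only [ne_eq, Prod.mk.injEq]; grind),
      pr_eq_zero_of_ae_ne (X := fun ω => (X ω, g (X ω), Z ω))
        (.of_forall fun ω => by simp only [ne_eq, Prod.mk.injEq]; grind)]
    ring

end FiniteLaws

/-- Every finitely supported law is realised on a probability space in `Type`. -/
lemma exists_probSpace_pr_eq {A : Type*} [Fintype A] [MeasurableSpace A]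
    (p : A → ℝ) (hp : ∀ a, 0 ≤ p a)
    (hsum : ∑ a, p a = 1) :
    ∃ (P : ProbSpace) (Y : P.carrier → A), Measurable Y ∧ ∀ a, pr P.μ Y a = p a := by
  classical
  let ε := Fintype.equivFin A
  let q : PMF (Fin (Fintype.card A)) := PMF.ofFintype (fun i => ENNReal.ofReal (p (ε.symm i)))
    (by
      rw [← ENNReal.ofReal_sum_of_nonneg (fun _ _ => hp _), Equiv.sum_comp ε.symm p, hsum,
        ENNReal.ofReal_one])
  refine ⟨⟨Fin (Fintype.card A), q.toMeasure⟩, ε.symm, measurable_of_finite _, fun a => ?_⟩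
  have : (ε.symm : _ → A) ⁻¹' {a} = {ε a} := by
    ext i; simp [Equiv.symm_apply_eq]
  unfold pr
  dsimp only
  rw [this, PMF.toMeasure_apply_singleton _ _ (measurableSet_singleton _)]
  simp [q, hp a]

section Observation

variable {k : ℕ} (S Sb : Finset (Fin k))

/-- The literals `(1 - wᵢ) f` for `i ∈ S` together with `wᵢ f` for `i ∈ Sb`. -/
def obs (w : Fin k → Fin 2) (f : Fin 2) : (S → Fin 2) × (Sb → Fin 2) :=
  (fun i => (1 - w i.1) * f, fun i => w i.1 * f)

/-- The label `w` is `1` on `S` and `0` on `Sb`. -/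
def Sat (w : Fin k → Fin 2) : Prop := (∀ i ∈ S, w i = 1) ∧ ∀ i ∈ Sb, w i = 0

lemma obs_eq_zero_iff (w : Fin k → Fin 2) (f : Fin 2) :
    obs S Sb w f = 0 ↔ f = 0 ∨ Sat S Sb w := by
  have h1 : ∀ v f : Fin 2, (1 - v) * f = 0 ↔ f = 0 ∨ v = 1 := by decide
  have h2 : ∀ v f : Fin 2, v * f = 0 ↔ f = 0 ∨ v = 0 := by decide
  simp only [obs, Sat, Prod.ext_iff, funext_iff, Prod.fst_zero, Prod.snd_zero, Pi.zero_apply,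
    h1, h2, Subtype.forall]
  by_cases hf : f = 0 <;> simp [hf]

end Observation

section Channel

open Classical in
/-- The conditional law of the adjoined variable: where the observation vanishes and some value is
satisfying, it marks the three possible configurations; otherwise it is uniform. -/
noncomputable def channel (active sat : Prop) (f : Fin 2) (u : Fin 3) : ℝ :=
  if active ∧ (f = 0 ∨ sat) then
    if u = (if f = 1 then 2 else if sat then 0 else 1) then 1 else 0
  else 3⁻¹

lemma channel_nonneg (active sat : Prop) (f : Fin 2) (u : Fin 3) :
    0 ≤ channel active sat f u := by
  unfold channel
  split_ifs <;> norm_num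

lemma sum_channel (active sat : Prop) (f : Fin 2) : ∑ u, channel active sat f u = 1 := by
  unfold channel
  by_cases h : active ∧ (f = 0 ∨ sat)
  · simp [h]
  · simp [h]

lemma sum_channel_const {A D : Type*} [Fintype A] [DecidableEq D] {r : A → ℝ} {c : ℝ}
    (h0 : ∀ x, 0 ≤ r x)
    (hr : ∀ x, r x = 0 ∨ r x = c) (h2 : {x | 0 < r x}.ncard = 2) {sat : A → Prop}
    (h1 : {x | 0 < r x ∧ sat x}.ncard ≤ 1) {g : A → Fin 2 → D} {o₀ : D}
    (hg : ∀ x f, g x f = o₀ ↔ f = 0 ∨ sat x) (o : D)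
    (u v : Fin 3) :
    ∑ f, ∑ x, (if g x f = o then r x * channel (∃ y, 0 < r y ∧ sat y) (sat x) f u else 0)
      = ∑ f, ∑ x, if g x f = o then r x * channel (∃ y, 0 < r y ∧ sat y) (sat x) f v else 0 := by
  by_cases hact : ∃ y, 0 < r y ∧ sat y
  swap
  · simp [channel, hact]
  obtain ⟨a, ha, hsa⟩ := id hact
  obtain ⟨b, hb, hba⟩ : ∃ b, 0 < r b ∧ b ≠ a :=
    Set.exists_ne_of_one_lt_ncard (s := {x | 0 < r x}) (by omega) a
  have hpos : ∀ x, 0 < r x → x = a ∨ x = b := by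
    intro x hx
    by_contra! hne
    have : ({a, b, x} : Set A).ncard ≤ {x | 0 < r x}.ncard :=
      Set.ncard_le_ncard (by
        rintro y (rfl | rfl | rfl) <;> assumption) (Set.toFinite _)
    rw [h2, Set.ncard_eq_three.2 ⟨a, b, x, hba.symm, hne.1.symm, hne.2.symm, rfl⟩] at this
    omega
  have hsb : ¬ sat b := fun hsb => hba (((Set.ncard_le_one (Set.toFinite _)).1 h1) b ⟨hb, hsb⟩ a
    ⟨ha, hsa⟩)
  have hab : r a = r b := by
    rw [(hr a).resolve_left ha.ne', (hr b).resolve_left hb.ne']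
  have hsum : ∀ φ : A → ℝ, (∀ x, r x = 0 → φ x = 0) → ∑ x, φ x = φ a + φ b := by
    intro φ hφ
    refine Finset.sum_eq_add a b hba.symm (fun x _ hx => hφ x ?_) (by simp) (by simp)
    by_contra hne
    rcases hpos x (lt_of_le_of_ne (h0 x) (Ne.symm hne)) with h | h
    · exact hx.1 h
    · exact hx.2 h
  have hone : (1 : Fin 2) ≠ 0 := by decide
  have g1 := hg a 0
  have g2 := hg a 1
  have g3 := hg b 0
  have g4 := hg b 1
  simp only [hsa, hsb, hone, or_true, or_false, iff_true, iff_false] at g1 g2 g3 g4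
  simp only [Fin.sum_univ_two]
  rw [hsum _ fun x hx => by simp [hx], hsum _ fun x hx => by simp [hx],
    hsum _ fun x hx => by simp [hx], hsum _ fun x hx => by simp [hx]]
  simp only [channel, hact, hsa, hsb, hab, g1, g2, g3]
  by_cases ho : o₀ = o
  · have : g b 1 ≠ o := ho ▸ g4
    fin_cases u <;> fin_cases v <;> simp [ho, this]
  · simp [ho]

end Channel

section Cold

variable {Ω : Type*} [MeasurableSpace Ω] {μ : Measure Ω} [IsProbabilityMeasure μ] {A B C : Type*}
  [MeasurableSpace A] [MeasurableSingletonClass A]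
  [Fintype B] [MeasurableSpace B] [MeasurableSingletonClass B]
  [Fintype C] [MeasurableSpace C] [MeasurableSingletonClass C]

/-- A fair bit independent of `W`, and of `X` given `W`, remains fair given `(X, E)` when `W` and
`E` are functions of `X`. -/
lemma pr_bit_eq_half {F : Ω → Fin 2} {W : Ω → A} {X : Ω → B} {E : Ω → C}
    (hXm : Measurable X) (hEm : Measurable E)
    (hFunif : ∀ f, pr μ F f = 2⁻¹) (hindep : IndepFun F W μ)
    (hci : ∀ f x w, pr μ (fun ω => (F ω, X ω, W ω)) (f, x, w) * pr μ W w
      = pr μ (fun ω => (F ω, W ω)) (f, w) * pr μ (fun ω => (X ω, W ω)) (x, w))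
    {φ : B → A} (hφ : ∀ᵐ ω ∂μ, W ω = φ (X ω)) (hE : condEnt μ E X = 0) (f : Fin 2) (x : B)
    (e : C) :
    pr μ (fun ω => (F ω, X ω, E ω)) (f, x, e) = 2⁻¹ * pr μ (fun ω => (X ω, E ω)) (x, e) := by
  classical
  have hFW : ∀ w, pr μ (fun ω => (F ω, W ω)) (f, w) = 2⁻¹ * pr μ W w := by
    intro w
    have h := hindep.measure_inter_preimage_eq_mul {f} {w} (measurableSet_singleton _)
      (measurableSet_singleton _)
    rw [← hFunif f]
    unfold pr
    rw [← ENNReal.toReal_mul, ← h]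
    congr 2
    ext ω
    simp
  have hXW : pr μ (fun ω => (X ω, W ω)) (x, φ x) = pr μ X x :=
    pr_congr_of_ae_iff (by
      filter_upwards [hφ] with ω hω
      simp only [Prod.mk.injEq]
      grind)
  have hFX : pr μ (fun ω => (F ω, X ω)) (f, x) = 2⁻¹ * pr μ X x := by
    have h1 : pr μ (fun ω => (F ω, X ω)) (f, x)
        = pr μ (fun ω => (F ω, X ω, W ω)) (f, x, φ x) :=
      pr_congr_of_ae_iff (by
        filter_upwards [hφ] with ω hω
        simp only [Prod.mk.injEq]
        grind)
    have hle : pr μ X x ≤ pr μ W (φ x) := hXW ▸ pr_pair_le_snd X W x (φ x)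
    rcases (pr_nonneg (μ := μ) X x).eq_or_lt with h0 | h0
    · rw [← h0, mul_zero]
      exact le_antisymm ((pr_pair_le_snd F X f x).trans h0.symm.le) (pr_nonneg _ _)
    · have h2 := hci f x (φ x)
      rw [hFW, hXW, ← h1] at h2
      have h3 := h0.trans_le hle
      refine mul_right_cancel₀ h3.ne' ?_
      rw [h2]
      ring
  have hXE : pr μ (fun ω => (E ω, X ω)) (e, x) = pr μ (fun ω => (X ω, E ω)) (x, e) :=
    pr_congr_of_ae_iff (.of_forall fun ω => by simp only [Prod.mk.injEq]; tauto)
  rcases (condEnt_eq_zero_iff hEm hXm).1 hE e x with h | h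
  · rw [← hXE, h, mul_zero]
    refine le_antisymm ((pr_pair_le_snd F (fun ω => (X ω, E ω)) f (x, e)).trans ?_)
      (pr_nonneg _ _)
    rw [← hXE, h]
  · have hae : ∀ᵐ ω ∂μ, X ω = x → E ω = e := by
      have h1 : ∀ᵐ ω ∂μ, ∀ e', e' ≠ e → (E ω, X ω) ≠ (e', x) := by
        rw [ae_all_iff]
        intro e'
        by_cases he : e' = e
        · exact .of_forall fun ω h => absurd he h
        · have h2 : pr μ (fun ω => (E ω, X ω)) (e', x) = 0 := by
            have h3 := pr_snd (μ := μ) hEm hXm x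
            rw [← h, ← Finset.sum_erase_add _ _ (Finset.mem_univ e), add_eq_right,
              Finset.sum_eq_zero_iff_of_nonneg fun _ _ => pr_nonneg _ _] at h3
            exact h3 e' (Finset.mem_erase.2 ⟨he, Finset.mem_univ _⟩)
          filter_upwards [ae_ne_of_pr_eq_zero h2] with ω hω _ using hω
      filter_upwards [h1] with ω hω hx
      by_contra hne
      exact hω _ hne (by rw [hx])
    rw [← hXE, h, ← hFX]
    refine pr_congr_of_ae_iff ?_
    filter_upwards [hae] with ω hω
    simp only [Prod.mk.injEq]
    tauto

/-- Conditioned on a value `e` of positive probability, a fair bit is not a function of an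
independent uniform variable with three values. -/
lemma not_determined_of_uniformOn_three {F : Ω → Fin 2} {E : Ω → B} {U : Ω → C}
    (hFm : Measurable F) (hEm : Measurable E) (hUm : Measurable U) (hU : UniformOn μ U 3) {e : B}
    (he : 0 < pr μ E e)
    (hF : pr μ (fun ω => (F ω, E ω)) (0, e) = 2⁻¹ * pr μ E e)
    (hind : ∀ u, pr μ (fun ω => (U ω, E ω)) (u, e) = pr μ U u * pr μ E e)
    (hdet : ∀ u, pr μ (fun ω => (U ω, F ω, E ω)) (u, 0, e) = 0 ∨
      pr μ (fun ω => (U ω, F ω, E ω)) (u, 0, e) = pr μ (fun ω => (U ω, E ω)) (u, e)) :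
    False := by
  classical
  have hUval : ∀ u, pr μ U u = 0 ∨ pr μ U u = 3⁻¹ := by
    intro u
    rcases (pr_nonneg (μ := μ) U u).eq_or_lt with h | h
    · exact Or.inl h.symm
    · right
      have hconst : ∑ v with 0 < pr μ U v, pr μ U v = ∑ v with 0 < pr μ U v, pr μ U u :=
        Finset.sum_congr rfl fun v hv => hU.1 v (Finset.mem_filter.1 hv).2 u h
      have hs := sum_pr (μ := μ) hUm
      rw [← Finset.sum_filter_add_sum_filter_not _ (fun u => 0 < pr μ U u),
        hconst, Finset.sum_eq_zero (s := Finset.univ.filter _)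
          (fun v hv => le_antisymm (not_lt.1 (Finset.mem_filter.1 hv).2) (pr_nonneg _ _)),
        Finset.sum_const, add_zero] at hs
      have hc : (Finset.univ.filter fun u => 0 < pr μ U u).card = 3 := by
        rw [← hU.2, ← Set.ncard_coe_finset]
        simp [support]
      rw [hc, nsmul_eq_mul] at hs
      push_cast at hs
      linarith
  have hterm : ∀ u, ∃ n : ℕ, pr μ (fun ω => (U ω, F ω, E ω)) (u, 0, e) = n * (pr μ E e / 3) := by
    intro u
    rcases hdet u with h | h
    · exact ⟨0, by simp [h]⟩
    · rw [h, hind]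
      rcases hUval u with h1 | h1
      · exact ⟨0, by simp [h1]⟩
      · exact ⟨1, by rw [h1]; push_cast; ring⟩
  choose n hn using hterm
  have hsum := pr_snd (μ := μ) hUm (hFm.prodMk hEm) (0, e)
  simp only [hn] at hsum
  rw [← Finset.sum_mul, hF, ← Nat.cast_sum] at hsum
  have h1 : (2 * (∑ u, n u : ℕ) : ℝ) = 3 := by
    field_simp at hsum
    linarith
  have h2 : 2 * (∑ u, n u) = 3 := by exact_mod_cast h1
  omega

end Cold

/-- in the COLD setup with E splitting X into sets of size 2, a uniform
3-valued U with I(U;(E,V_S,V̄_S̄)) = 0 and H(F|V_S,V̄_S̄,E,U) = 0 can be adjoined iff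
aCount μ k X E wfun S Sb e ≤ 1 holds for every e of positive probability. -/
theorem stmt_10 {Ω : Type*} [MeasurableSpace Ω] (μ : Measure Ω) [IsProbabilityMeasure μ]
    (k : ℕ) (hk : 1 ≤ k)
    (F : Ω → Fin 2) (W : Ω → (Fin k → Fin 2))
    (hFm : Measurable F) (hWm : Measurable W)
    (hFunif : ∀ x : Fin 2, pr μ F x = 2⁻¹)
    (hindep : IndepFun F W μ)
    (V Vb : Fin k → Ω → Fin 2)
    (hV : ∀ i ω, V i ω = (1 - W ω i) * F ω)
    (hVb : ∀ i ω, Vb i ω = W ω i * F ω)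
    {SX SE : Type*} [Fintype SX] [Fintype SE]
    [MeasurableSpace SX] [MeasurableSingletonClass SX]
    [MeasurableSpace SE] [MeasurableSingletonClass SE]
    (X : Ω → SX) (hXm : Measurable X)
    (wfun : SX → (Fin k → Fin 2)) (hwfun : μ {ω | W ω = wfun (X ω)} = 1)
    (hcmi : cmi μ (fun ω => ((fun i => V i ω), (fun i => Vb i ω), F ω)) X W = 0)
    (E : Ω → SE) (hEm : Measurable E) (hsplit : Splits μ X E 2)
    (S Sb : Finset (Fin k)) :
    (∃ (P : ProbSpace) (F' : P.carrier → Fin 2) (W' : P.carrier → (Fin k → Fin 2))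
      (X' : P.carrier → SX) (E' : P.carrier → SE)
      (TU : FinAlphabet) (U : P.carrier → TU.carrier),
      Measurable F' ∧ Measurable W' ∧ Measurable X' ∧ Measurable E' ∧ Measurable U ∧
      IdentDistrib (fun ω => (F ω, W ω, X ω, E ω))
        (fun ω => (F' ω, W' ω, X' ω, E' ω)) μ P.μ ∧
      UniformOn P.μ U 3 ∧
      mi P.μ U (fun ω => (E' ω, (fun i : S => (1 - W' ω i.1) * F' ω),
        (fun i : Sb => W' ω i.1 * F' ω))) = 0 ∧
      condEnt P.μ F' (fun ω => ((fun i : S => (1 - W' ω i.1) * F' ω),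
        (fun i : Sb => W' ω i.1 * F' ω), E' ω, U ω)) = 0) ↔
    (∀ e : SE, 0 < pr μ E e → aCount μ k X E wfun S Sb e ≤ 1) := by
  have hw : ∀ᵐ ω ∂μ, W ω = wfun (X ω) :=
    (mem_ae_iff_prob_eq_one (measurableSet_eq_fun hWm
      ((measurable_of_finite wfun).comp hXm))).2 hwfun
  have hVm : Measurable fun ω => ((fun i => V i ω), (fun i => Vb i ω), F ω) := by
    simp only [hV, hVb]
    exact (measurable_of_finite (fun p : (Fin k → Fin 2) × Fin 2 =>
      ((fun i => (1 - p.1 i) * p.2), (fun i => p.1 i * p.2), p.2))).comp (hWm.prodMk hFm)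
  have hlaw := pr_bit_eq_half hXm hEm hFunif hindep
    (pr_comp_mul_of_cmi_eq_zero hVm hXm hWm hcmi fun v => v.2.2) hw hsplit.1
  have hFE : ∀ f e, pr μ (fun ω => (F ω, E ω)) (f, e) = 2⁻¹ * pr μ E e := by
    intro f e
    rw [← pr_snd hXm (hFm.prodMk hEm), ← pr_snd hXm hEm, Finset.mul_sum]
    refine Finset.sum_congr rfl fun x _ => ?_
    rw [← hlaw]
    exact pr_congr_of_ae_iff (.of_forall fun ω => by simp only [Prod.mk.injEq]; tauto)
  constructor
  · rintro ⟨P, F', W', X', E', TU, U, hFm', hWm', hXm', hEm', hUm, hid, hU, hmi, hce⟩ e he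
    by_contra! hcount
    obtain ⟨-, hcard⟩ := hsplit.2 e he
    have hsat : ∀ x, 0 < pr μ (fun ω => (X ω, E ω)) (x, e) → Sat S Sb (wfun x) := by
      have heq : {x | 0 < pr μ (fun ω => (X ω, E ω)) (x, e) ∧ Sat S Sb (wfun x)}
          = {x | 0 < pr μ (fun ω => (X ω, E ω)) (x, e)} :=
        Set.eq_of_subset_of_ncard_le (fun x hx => hx.1) (hcard.le.trans hcount)
          (Set.toFinite _)
      intro x hx
      exact (heq.symm ▸ hx : x ∈ {x | 0 < pr μ (fun ω => (X ω, E ω)) (x, e) ∧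
        Sat S Sb (wfun x)}).2
    have hsatμ : ∀ᵐ ω ∂μ, (F ω, W ω, X ω, E ω) ∈
        {t : Fin 2 × (Fin k → Fin 2) × SX × SE | t.2.2.2 = e → Sat S Sb t.2.1} := by
      filter_upwards [hw, ae_pr_pos (μ := μ) fun ω => (X ω, E ω)] with ω h1 h2 (h3 : E ω = e)
      rw [h1]
      rw [h3] at h2
      exact hsat _ h2
    have hobs : ∀ᵐ ω ∂P.μ, E' ω = e → obs S Sb (W' ω) (F' ω) = 0 := by
      filter_upwards [hid.ae_mem_snd (Set.toFinite _).measurableSet hsatμ] with ω h1 h2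
      exact (obs_eq_zero_iff S Sb _ _).2 (Or.inr (h1 h2))
    have hOm : Measurable fun ω => obs S Sb (W' ω) (F' ω) :=
      (measurable_of_finite fun p : (Fin k → Fin 2) × Fin 2 => obs S Sb p.1 p.2).comp
        (hWm'.prodMk hFm')
    have hind := (mi_eq_zero_iff hUm (hEm'.prodMk hOm)).1 hmi
    have hdet := (condEnt_eq_zero_iff hFm'
      (hOm.fst.prodMk (hOm.snd.prodMk (hEm'.prodMk hUm)))).1 hce
    have hEe : pr μ E e = pr P.μ E' e :=
      pr_eq_of_identDistrib (hid.comp measurable_snd.snd.snd) e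
    have hFEe : pr μ (fun ω => (F ω, E ω)) (0, e) = pr P.μ (fun ω => (F' ω, E' ω)) (0, e) :=
      pr_eq_of_identDistrib (hid.comp (measurable_fst.prodMk measurable_snd.snd.snd)) (0, e)
    have hEO : pr P.μ (fun ω => (E' ω, obs S Sb (W' ω) (F' ω))) (e, 0) = pr P.μ E' e :=
      pr_congr_of_ae_iff (by
        filter_upwards [hobs] with ω hω
        simp only [Prod.mk.injEq]
        tauto)
    refine not_determined_of_uniformOn_three hFm' hEm' hUm hU (hEe ▸ he)
      (by rw [← hFEe, hFE, hEe]) (fun u => ?_) fun u => ?_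
    · rw [← hEO, ← hind]
      refine pr_congr_of_ae_iff ?_
      filter_upwards [hobs] with ω hω
      simp only [Prod.mk.injEq]
      tauto
    · have h1 : pr P.μ (fun ω => (U ω, F' ω, E' ω)) (u, 0, e)
          = pr P.μ (fun ω => (F' ω, (obs S Sb (W' ω) (F' ω)).1, (obs S Sb (W' ω) (F' ω)).2,
              E' ω, U ω)) (0, 0, 0, e, u) :=
        pr_congr_of_ae_iff (by
          filter_upwards [hobs] with ω hω
          simp only [Prod.ext_iff, Prod.fst_zero, Prod.snd_zero] at hω ⊢
          tauto)
      have h2 : pr P.μ (fun ω => (U ω, E' ω)) (u, e)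
          = pr P.μ (fun ω => ((obs S Sb (W' ω) (F' ω)).1, (obs S Sb (W' ω) (F' ω)).2,
              E' ω, U ω)) (0, 0, e, u) :=
        pr_congr_of_ae_iff (by
          filter_upwards [hobs] with ω hω
          simp only [Prod.ext_iff, Prod.fst_zero, Prod.snd_zero] at hω ⊢
          tauto)
      rw [h1, h2]
      exact hdet 0 (0, 0, e, u)
  · intro hcount
    set r : SX → SE → ℝ := fun x e => pr μ (fun ω => (X ω, E ω)) (x, e) with hr
    have r0 : ∀ x e, 0 ≤ r x e := fun x e => pr_nonneg _ _
    let act : SE → Prop := fun e => ∃ y, 0 < r y e ∧ Sat S Sb (wfun y)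
    let p : Fin 2 × SX × SE × Fin 3 → ℝ := fun t =>
      2⁻¹ * (r t.2.1 t.2.2.1 * channel (act t.2.2.1) (Sat S Sb (wfun t.2.1)) t.1 t.2.2.2)
    have hp0 : ∀ t, 0 ≤ p t := fun t =>
      mul_nonneg (by norm_num) (mul_nonneg (r0 _ _) (channel_nonneg _ _ _ _))
    have hmarg : ∀ f x e, ∑ u, p (f, x, e, u) = 2⁻¹ * r x e := by
      intro f x e
      simp only [p, ← Finset.mul_sum, sum_channel, mul_one]
    have hp1 : ∑ t, p t = 1 := by
      simp only [Fintype.sum_prod_type, hmarg, hr, ← Finset.mul_sum, pr_fst hXm hEm, sum_pr hXm]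
      simp
    obtain ⟨P, Y, hY, hYp⟩ := exists_probSpace_pr_eq p hp0 hp1
    have hFm' : Measurable fun ω => (Y ω).1 := hY.fst
    have hXm' : Measurable fun ω => (Y ω).2.1 := hY.snd.fst
    have hEm' : Measurable fun ω => (Y ω).2.2.1 := hY.snd.snd.fst
    have hUm : Measurable fun ω => (Y ω).2.2.2 := hY.snd.snd.snd
    have hwm : Measurable fun ω => wfun (Y ω).2.1 := (measurable_of_finite wfun).comp hXm'
    have hOm : Measurable fun ω => obs S Sb (wfun (Y ω).2.1) (Y ω).1 :=
      (measurable_of_finite fun q : (Fin k → Fin 2) × Fin 2 => obs S Sb q.1 q.2).comp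
        (hwm.prodMk hFm')
    have hEOm := hEm'.prodMk hOm
    classical
    have hjoint : ∀ u e o,
        pr P.μ (fun ω => ((Y ω).2.2.2, (Y ω).2.2.1, obs S Sb (wfun (Y ω).2.1) (Y ω).1)) (u, e, o)
          = 2⁻¹ * ∑ f, ∑ x, if obs S Sb (wfun x) f = o then
              r x e * channel (act e) (Sat S Sb (wfun x)) f u else 0 := by
      intro u e o
      rw [← pr_snd (hFm'.prodMk hXm') (hUm.prodMk hEOm), Fintype.sum_prod_type, Finset.mul_sum]
      refine Finset.sum_congr rfl fun f _ => ?_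
      rw [Finset.mul_sum]
      refine Finset.sum_congr rfl fun x _ => ?_
      split_ifs with ho
      · refine (pr_congr_of_ae_iff (.of_forall fun ω => ?_)).trans (hYp (f, x, e, u))
        simp only [Prod.ext_iff (x := Y ω), Prod.ext_iff (x := (Y ω).2),
          Prod.ext_iff (x := (Y ω).2.2), Prod.mk.injEq]
        grind
      · rw [mul_zero]
        refine pr_eq_zero_of_ae_ne (.of_forall fun ω h => ho ?_)
        simp only [Prod.mk.injEq] at h
        obtain ⟨⟨rfl, rfl⟩, -, -, h⟩ := h
        exact h
    have hconst : ∀ u v e o,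
        pr P.μ (fun ω => ((Y ω).2.2.2, (Y ω).2.2.1, obs S Sb (wfun (Y ω).2.1) (Y ω).1)) (u, e, o)
          = pr P.μ (fun ω => ((Y ω).2.2.2, (Y ω).2.2.1, obs S Sb (wfun (Y ω).2.1) (Y ω).1))
            (v, e, o) := by
      intro u v e o
      rw [hjoint, hjoint]
      congr 1
      rcases (pr_nonneg (μ := μ) E e).eq_or_lt with he | he
      · have hz : ∀ x, r x e = 0 := fun x =>
          le_antisymm ((pr_pair_le_snd X E x e).trans he.symm.le) (r0 x e)
        simp [hz]
      · obtain ⟨hval, hcard⟩ := hsplit.2 e he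
        exact sum_channel_const (r := fun x => r x e) (fun x => r0 x e) hval hcard
          (sat := fun x => Sat S Sb (wfun x)) (hcount e he)
          (g := fun x f => obs S Sb (wfun x) f)
          (fun x f => obs_eq_zero_iff S Sb (wfun x) f) o u v
    have hthird : ∀ u o, pr P.μ (fun ω => ((Y ω).2.2.2, ((Y ω).2.2.1,
        obs S Sb (wfun (Y ω).2.1) (Y ω).1))) (u, o)
          = 3⁻¹ * pr P.μ (fun ω => ((Y ω).2.2.1, obs S Sb (wfun (Y ω).2.1) (Y ω).1)) o := by
      rintro u ⟨e, o⟩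
      rw [← pr_snd hUm hEOm, Finset.sum_congr rfl fun v _ => hconst v u e o]
      simp
    have hUpr : ∀ u, pr P.μ (fun ω => (Y ω).2.2.2) u = 3⁻¹ := by
      intro u
      rw [← pr_fst hUm hEOm, Finset.sum_congr rfl fun o _ => hthird u o, ← Finset.mul_sum,
        sum_pr hEOm, mul_one]
    refine ⟨P, fun ω => (Y ω).1, fun ω => wfun (Y ω).2.1, fun ω => (Y ω).2.1,
      fun ω => (Y ω).2.2.1, ⟨Fin 3⟩, fun ω => (Y ω).2.2.2, hFm', hwm, hXm', hEm', hUm,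
      ?_, ⟨?_, ?_⟩, ?_, ?_⟩
    · have h1 : IdentDistrib (fun ω => (F ω, X ω, E ω))
          (fun ω => ((Y ω).1, (Y ω).2.1, (Y ω).2.2.1)) μ P.μ := by
        refine identDistrib_of_pr (hFm.prodMk (hXm.prodMk hEm))
          (hFm'.prodMk (hXm'.prodMk hEm')) ?_
        rintro ⟨f, x, e⟩
        rw [hlaw, ← pr_snd hUm (hFm'.prodMk (hXm'.prodMk hEm')), ← hmarg f x e]
        refine Finset.sum_congr rfl fun u _ => ?_
        rw [← hYp]
        refine pr_congr_of_ae_iff (.of_forall fun ω => ?_)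
        simp only [Prod.ext_iff]
        tauto
      refine (IdentDistrib.of_ae_eq
        (hFm.prodMk (hWm.prodMk (hXm.prodMk hEm))).aemeasurable ?_).trans
        (h1.comp (u := fun t : Fin 2 × SX × SE => (t.1, wfun t.2.1, t.2.1, t.2.2))
          (measurable_of_finite _))
      filter_upwards [hw] with ω hω
      simp [hω]
    · intro u _ v _
      rw [hUpr, hUpr]
    · have : support P.μ (fun ω => (Y ω).2.2.2) = Set.univ := by
        ext u
        simp [support, hUpr]
      rw [this, Set.ncard_univ, Nat.card_fin]
    · refine (mi_eq_zero_iff hUm hEOm).2 fun u o => ?_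
      rw [hthird, hUpr]
    · let dec : (S → Fin 2) × (Sb → Fin 2) × SE × Fin 3 → Fin 2 := fun y =>
        if (y.1, y.2.1) = 0 then (if act y.2.2.1 ∧ y.2.2.2 = 2 then 1 else 0) else 1
      have hdec : ∀ᵐ ω ∂P.μ, (Y ω).1 = dec ((obs S Sb (wfun (Y ω).2.1) (Y ω).1).1,
          (obs S Sb (wfun (Y ω).2.1) (Y ω).1).2, (Y ω).2.2.1, (Y ω).2.2.2) := by
        filter_upwards [ae_pr_pos (μ := P.μ) Y] with ω hω
        rw [hYp] at hω
        revert hω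
        generalize Y ω = t
        obtain ⟨f, x, e, u⟩ := t
        intro hω
        have h1 : 0 < r x e * channel (act e) (Sat S Sb (wfun x)) f u := by
          simp only [p] at hω
          linarith
        have h2 : r x e ≠ 0 := fun h => by simp [h] at h1
        have h3 : channel (act e) (Sat S Sb (wfun x)) f u ≠ 0 := fun h => by simp [h] at h1
        have h4 : Sat S Sb (wfun x) → act e := fun h =>
          ⟨x, lt_of_le_of_ne (r0 x e) (Ne.symm h2), h⟩
        simp only [dec, Prod.mk.eta, obs_eq_zero_iff]
        have hf : f = 0 ∨ f = 1 := by omega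
        unfold channel at h3
        rcases hf with rfl | rfl
        · by_cases ha : act e
          · simp only [ha, true_or, and_self, if_true, ne_eq, ite_eq_right_iff, one_ne_zero,
              imp_false, not_not] at h3
            by_cases hs : Sat S Sb (wfun x) <;> simp [h3, hs]
          · simp [ha]
        · by_cases hs : Sat S Sb (wfun x)
          · simp [h4 hs, hs] at h3 ⊢
            exact h3
          · simp [hs]
      refine (condEnt_eq_zero_iff hFm'
        (hOm.fst.prodMk (hOm.snd.prodMk (hEm'.prodMk hUm)))).2 fun f y => ?_
      by_cases hf : f = dec y
      · right
        refine pr_congr_of_ae_iff ?_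
        filter_upwards [hdec] with ω hω
        rw [Prod.mk.injEq, and_iff_right_iff_imp]
        intro h
        rw [hω, h, hf]
      · left
        refine pr_eq_zero_of_ae_ne ?_
        filter_upwards [hdec] with ω hω h
        rw [Prod.mk.injEq] at h
        exact hf (h.1.symm.trans (hω.trans (congrArg dec h.2)))

end CIPaper
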